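/- arXiv:2112.11712 — 3 statements merged into one kernel-verified Lean document; each statement's English description precedes it below -/
import Mathlib

section
/- Let G be a simple graph on n vertices and let A ∈ S(G) be a matrix with the strong spectral property (SSP) whose eigenvalues, counted with multiplicity, are λ1, …, λn. Then there is ε > 0 such that for any real numbers μ1, …, μn with |μi − λi| < ε for all i = 1, …, n, there exists a matrix A' ∈ S(G) with the SSP whose multiset of eigenvalues (with multiplicity) is {μ1, …, μn}. -/
open Matrix Polynomial

/-- `A` belongs to `S(G)`: symmetric, with off-diagonal nonzero pattern given by `G`. -/
def sMem {n : ℕ} (G : SimpleGraph (Fin n)) (A : Matrix (Fin n) (Fin n) ℝ) : Prop :=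
  A.IsSymm ∧ ∀ i j, i ≠ j → (A i j ≠ 0 ↔ G.Adj i j)

/-- The strong spectral property. -/
def HasSSP {n : ℕ} (A : Matrix (Fin n) (Fin n) ℝ) : Prop :=
  ∀ X : Matrix (Fin n) (Fin n) ℝ, X.IsSymm →
    (∀ i j, A i j * X i j = 0) → (∀ i, X i i = 0) → A * X = X * A → X = 0

section Helpers

open Filter Topology

theorem hasStrictFDerivAt_exp_neg_mul_mul_exp {E R : Type*} [NormedAddCommGroup E]
    [NormedSpace ℝ E] [NormedRing R] [NormedAlgebra ℝ R] [CompleteSpace R]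
    (b k : E →L[ℝ] R) (x : E) (hx : k x = 0) :
    HasStrictFDerivAt (fun y => NormedSpace.exp (-(k y)) * b y * NormedSpace.exp (k y))
      (b + (ContinuousLinearMap.mul ℝ R (b x)).comp k
        - ((ContinuousLinearMap.mul ℝ R).flip (b x)).comp k) x := by
  have hk : HasStrictFDerivAt (fun y => NormedSpace.exp (k y)) k x := by
    have h : HasStrictFDerivAt NormedSpace.exp (1 : R →L[ℝ] R) (k x) :=
      hx ▸ hasStrictFDerivAt_exp_zero
    exact h.comp x k.hasStrictFDerivAt
  have hk' : HasStrictFDerivAt (fun y => NormedSpace.exp (-(k y))) (-k) x := by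
    have h : HasStrictFDerivAt NormedSpace.exp (1 : R →L[ℝ] R) ((-k) x) := by
      simpa [hx] using hasStrictFDerivAt_exp_zero
    exact h.comp x (-k).hasStrictFDerivAt
  refine ((hk'.mul' b.hasStrictFDerivAt).mul' hk).congr_fderiv ?_
  ext y
  simp [hx]
  abel

theorem map_nhds_exp_conj_add {R : Type*} [NormedRing R] [NormedAlgebra ℝ R]
    [FiniteDimensional ℝ R] (P S : R →ₗ[ℝ] R) (a : R) (hP : P a = a) (hS : S a = 0)
    (hsurj : ∀ c, ∃ p : R × R, P p.1 + a * S p.2 - S p.2 * a + S p.1 = c) :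
    map (fun p : R × R => NormedSpace.exp (-S p.2) * P p.1 * NormedSpace.exp (S p.2) + S p.1)
      (𝓝 (a, 0)) = 𝓝 a := by
  have : CompleteSpace R := FiniteDimensional.complete ℝ R
  let p₁ := ContinuousLinearMap.fst ℝ R R
  let p₂ := ContinuousLinearMap.snd ℝ R R
  let P' := P.toContinuousLinearMap
  let S' := S.toContinuousLinearMap
  have hder := (hasStrictFDerivAt_exp_neg_mul_mul_exp (P'.comp p₁) (S'.comp p₂) (a, 0)
    (by simp [p₂])).add (S'.comp p₁).hasStrictFDerivAt
  have hmap := hder.map_nhds_eq_of_surj (LinearMap.range_eq_top.2 fun c => by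
    obtain ⟨p, hp⟩ := hsurj c
    exact ⟨p, by simpa [P', S', p₁, p₂, hP] using hp⟩)
  refine hmap.trans (congrArg 𝓝 ?_)
  simp [P', S', p₁, p₂, hP, hS]

theorem isOpen_setOf_commute_imp_eq_zero {R F : Type*} [NormedRing R] [NormedAlgebra ℝ R]
    [FiniteDimensional ℝ R] [NormedAddCommGroup F] [NormedSpace ℝ F] (q : R →L[ℝ] F) :
    IsOpen {b : R | ∀ x, b * x = x * b → q x = 0 → x = 0} := by
  let T : R → R →L[ℝ] R × F := fun b =>
    (ContinuousLinearMap.inl ℝ R F).comp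
      (ContinuousLinearMap.mul ℝ R b - (ContinuousLinearMap.mul ℝ R).flip b)
    + (ContinuousLinearMap.inr ℝ R F).comp q
  have hT : Continuous T := by fun_prop
  convert! ContinuousLinearMap.isOpen_injective.preimage hT using 1
  ext b
  simp [injective_iff_map_eq_zero, T, sub_eq_zero]

variable {n : ℕ}

/-- The linear projection onto the symmetric matrices whose off-diagonal support lies in `G`. -/
noncomputable def patternProj (G : SimpleGraph (Fin n)) :
    Matrix (Fin n) (Fin n) ℝ →ₗ[ℝ] Matrix (Fin n) (Fin n) ℝ := by
  classical exact
  { toFun := fun B => of fun i j => if i = j ∨ G.Adj i j then (B i j + B j i) / 2 else 0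
    map_add' := fun B C => by
      ext i j
      simp only [of_apply, Matrix.add_apply]
      split_ifs <;> ring
    map_smul' := fun c B => by
      ext i j
      simp only [of_apply, Matrix.smul_apply, smul_eq_mul, RingHom.id_apply]
      split_ifs <;> ring }

theorem patternProj_apply_of {G : SimpleGraph (Fin n)} {i j : Fin n} (h : i = j ∨ G.Adj i j)
    (B : Matrix (Fin n) (Fin n) ℝ) : patternProj G B i j = (B i j + B j i) / 2 :=
  if_pos h

theorem patternProj_apply_of_not {G : SimpleGraph (Fin n)} {i j : Fin n}
    (h : ¬(i = j ∨ G.Adj i j)) (B : Matrix (Fin n) (Fin n) ℝ) : patternProj G B i j = 0 :=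
  if_neg h

theorem patternProj_isSymm (G : SimpleGraph (Fin n)) (B : Matrix (Fin n) (Fin n) ℝ) :
    (patternProj G B).IsSymm := by
  ext i j
  rw [transpose_apply]
  by_cases h : i = j ∨ G.Adj i j
  · rw [patternProj_apply_of h, patternProj_apply_of (h.imp Eq.symm fun h' => h'.symm), add_comm]
  · rw [patternProj_apply_of_not h,
      patternProj_apply_of_not (fun h' => h (h'.imp Eq.symm fun h' => h'.symm))]

theorem sMem.patternProj_eq {G : SimpleGraph (Fin n)} {A : Matrix (Fin n) (Fin n) ℝ}
    (hA : sMem G A) : patternProj G A = A := by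
  ext i j
  by_cases h : i = j ∨ G.Adj i j
  · rw [patternProj_apply_of h, hA.1.apply i j]
    ring
  · rw [patternProj_apply_of_not h]
    push Not at h
    by_contra h0
    exact h.2 ((hA.2 i j h.1).1 (Ne.symm h0))

/-- The linear map `B ↦ B - Bᵀ`. -/
def subTranspose : Matrix (Fin n) (Fin n) ℝ →ₗ[ℝ] Matrix (Fin n) (Fin n) ℝ :=
  LinearMap.id - (transposeLinearEquiv (Fin n) (Fin n) ℝ ℝ).toLinearMap

@[simp]
theorem subTranspose_apply (B : Matrix (Fin n) (Fin n) ℝ) : subTranspose B = B - Bᵀ := rfl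

/-- For a symmetric matrix with pattern `G`, the strong spectral property says that these two
conditions on a matrix have no common nonzero solution. -/
theorem sMem.hasSSP_iff {G : SimpleGraph (Fin n)} {A : Matrix (Fin n) (Fin n) ℝ}
    (hA : sMem G A) :
    HasSSP A ↔ ∀ X, A * X = X * A → X.IsSymm → patternProj G X = 0 → X = 0 := by
  refine ⟨fun h X hc hs hp => ?_, fun h X hs hX hd hc => h X hc hs ?_⟩
  · have key : ∀ i j, i = j ∨ G.Adj i j → X i j = 0 := fun i j hij => by
      have := congrFun₂ hp i j
      rw [patternProj_apply_of hij, hs.apply i j] at this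
      simpa using this
    refine h X hs (fun i j => ?_) (fun i => key i i (.inl rfl)) hc
    by_cases hij : i = j ∨ G.Adj i j
    · rw [key i j hij, mul_zero]
    · push Not at hij
      rw [not_ne_iff.1 (mt (hA.2 i j hij.1).1 hij.2), zero_mul]
  · ext i j
    by_cases hij : i = j ∨ G.Adj i j
    · have : X i j = 0 := by
        by_cases hne : i = j
        · exact hne ▸ hd i
        · exact (mul_eq_zero.1 (hX i j)).resolve_left
            ((hA.2 i j hne).2 (hij.resolve_left hne))
      rw [patternProj_apply_of hij, hs.apply i j, this]
      simp
    · exact patternProj_apply_of_not hij X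

theorem linearMap_eq_sum_mul (f : Matrix (Fin n) (Fin n) ℝ →ₗ[ℝ] ℝ)
    (B : Matrix (Fin n) (Fin n) ℝ) : f B = ((of fun i j => f (single j i 1)) * B).trace := by
  conv_lhs => rw [matrix_eq_sum_single B]
  simp only [map_sum, trace, diag_apply, mul_apply, of_apply]
  rw [Finset.sum_comm]
  refine Finset.sum_congr rfl fun j _ => Finset.sum_congr rfl fun i _ => ?_
  rw [← mul_one (B i j), ← smul_eq_mul, ← smul_single, map_smul, smul_eq_mul, smul_eq_mul]
  ring

theorem eq_zero_of_trace_transpose_mul_self {B : Matrix (Fin n) (Fin n) ℝ}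
    (h : (Bᵀ * B).trace = 0) : B = 0 := by
  rwa [← conjTranspose_eq_transpose_of_trivial, trace_conjTranspose_mul_self_eq_zero_iff] at h

/-- The dual form of the strong spectral property: the derivative of the orthogonal conjugation map
is surjective. -/
theorem sMem.exists_of_hasSSP {G : SimpleGraph (Fin n)} {A : Matrix (Fin n) (Fin n) ℝ}
    (hA : sMem G A) (hssp : HasSSP A)
    (C : Matrix (Fin n) (Fin n) ℝ) :
    ∃ p : Matrix (Fin n) (Fin n) ℝ × Matrix (Fin n) (Fin n) ℝ, patternProj G p.1
      + A * subTranspose p.2 - subTranspose p.2 * A + subTranspose p.1 = C := by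
  let p₁ := LinearMap.fst ℝ (Matrix (Fin n) (Fin n) ℝ) (Matrix (Fin n) (Fin n) ℝ)
  let p₂ := LinearMap.snd ℝ (Matrix (Fin n) (Fin n) ℝ) (Matrix (Fin n) (Fin n) ℝ)
  let L := patternProj G ∘ₗ p₁ + LinearMap.mulLeft ℝ A ∘ₗ subTranspose ∘ₗ p₂
    - LinearMap.mulRight ℝ A ∘ₗ subTranspose ∘ₗ p₂ + subTranspose ∘ₗ p₁
  suffices LinearMap.range L = ⊤ from LinearMap.range_eq_top.1 this C
  by_contra hne
  obtain ⟨f, hf0, hf⟩ := Submodule.exists_le_ker_of_lt_top _ (lt_top_iff_ne_top.2 hne)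
  set X : Matrix (Fin n) (Fin n) ℝ := of fun i j => f (single j i 1) with hXdef
  have hfX : ∀ B, f B = (X * B).trace := linearMap_eq_sum_mul f
  have hvan : ∀ B K, (X * (patternProj G B + A * subTranspose K - subTranspose K * A
      + subTranspose B)).trace = 0 := fun B K => by
    have := hf ⟨(B, K), rfl⟩
    rwa [LinearMap.mem_ker, hfX] at this
  have hsymm : X.IsSymm := by
    have hP : patternProj G (Xᵀ - X) = 0 := by
      ext i j
      by_cases h : i = j ∨ G.Adj i j
      · simp [patternProj_apply_of h]
      · exact patternProj_apply_of_not h _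
    have h := hvan (Xᵀ - X) 0
    have hS : subTranspose (Xᵀ - X) = (2 : ℝ) • (Xᵀ - X) := by
      rw [subTranspose_apply, transpose_sub, transpose_transpose, two_smul]
      abel
    rw [hP, hS] at h
    have h1 : (X * (Xᵀ - X)).trace = 0 := by simpa using h
    have h2 : (Xᵀ * (Xᵀ - X)).trace = -(X * (Xᵀ - X)).trace := by
      rw [← trace_transpose, transpose_mul, transpose_sub, transpose_transpose, trace_mul_comm,
        ← trace_neg, ← Matrix.mul_neg, neg_sub]
    refine sub_eq_zero.1 (eq_zero_of_trace_transpose_mul_self ?_)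
    rw [transpose_sub, transpose_transpose, Matrix.sub_mul, trace_sub, h2, h1]
    simp
  have hpat : patternProj G X = 0 := by
    have hsP := patternProj_isSymm G X
    have h := hvan (patternProj G X) 0
    have hPP : patternProj G (patternProj G X) = patternProj G X := by
      ext i j
      by_cases hij : i = j ∨ G.Adj i j
      · rw [patternProj_apply_of hij, hsP.apply i j]
        ring
      · rw [patternProj_apply_of_not hij, patternProj_apply_of_not hij]
    rw [hPP, subTranspose_apply, subTranspose_apply, hsP.eq] at h
    refine eq_zero_of_trace_transpose_mul_self ?_
    rw [hsP.eq]
    have h1 : (X * patternProj G X).trace = 0 := by simpa using h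
    rw [← h1]
    simp only [trace, diag_apply, mul_apply]
    refine Finset.sum_congr rfl fun i _ => Finset.sum_congr rfl fun j _ => ?_
    rw [hsP.apply i j]
    by_cases hij : i = j ∨ G.Adj i j
    · rw [patternProj_apply_of hij, hsymm.apply i j]
      ring
    · rw [patternProj_apply_of_not hij]
      simp
  have hcomm : A * X = X * A := by
    set K := A * X - X * A with hK
    have hKt : Kᵀ = -K := by
      rw [hK, transpose_sub, transpose_mul, transpose_mul, hA.1.eq, hsymm.eq, neg_sub]
    have h := hvan 0 K
    have hS : subTranspose K = (2 : ℝ) • K := by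
      rw [subTranspose_apply, hKt, two_smul, sub_neg_eq_add]
    rw [hS] at h
    refine sub_eq_zero.1 (eq_zero_of_trace_transpose_mul_self (B := K) ?_)
    have h1 : (X * (A * K)).trace - (X * (K * A)).trace = 0 := by
      simp only [map_zero, zero_add, add_zero, Matrix.mul_smul, Matrix.smul_mul, ← smul_sub,
        Matrix.mul_sub, trace_smul, trace_sub, smul_eq_mul] at h
      linarith
    rw [← Matrix.mul_assoc, ← Matrix.mul_assoc, trace_mul_comm (X * K), ← Matrix.mul_assoc,
      ← trace_sub, ← Matrix.sub_mul] at h1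
    rwa [hKt, hK, neg_sub]
  have hX0 := (hA.hasSSP_iff.1 hssp) X hcomm hsymm hpat
  exact hf0 (LinearMap.ext fun B => by rw [hfX, hX0]; simp)

theorem exists_perm_of_prod_X_sub_C_eq {ι : Type*} [Fintype ι] {a b : ι → ℝ}
    (h : ∏ i, (X - C (a i)) = ∏ i, (X - C (b i))) : ∃ σ : Equiv.Perm ι, b = a ∘ σ := by
  classical
  have h' := congrArg roots h
  have key : ∀ c : ι → ℝ, (∏ i, (X - C (c i))).roots = Finset.univ.val.map c := fun c => by
    rw [roots_prod _ _ (Finset.prod_ne_zero_iff.2 fun i _ => X_sub_C_ne_zero _)]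
    simp [Multiset.bind_singleton]
  rw [key, key] at h'
  have hfib : ∀ c, Fintype.card {i // b i = c} = Fintype.card {i // a i = c} := fun c => by
    have := congrArg (Multiset.count c) h'
    simp only [Multiset.count_map, eq_comm (a := c)] at this
    rw [Fintype.card_subtype, Fintype.card_subtype]
    exact this.symm
  exact ⟨Equiv.ofFiberEquiv fun c => Fintype.equivOfCardEq (hfib c),
    funext fun i => (Equiv.ofFiberEquiv_map _ i).symm⟩

attribute [local instance] Matrix.linftyOpNormedRing Matrix.linftyOpNormedAlgebra

theorem eventually_sMem {G : SimpleGraph (Fin n)} {A : Matrix (Fin n) (Fin n) ℝ}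
    (hA : sMem G A) : ∀ᶠ B in 𝓝 A, sMem G (patternProj G B) := by
  have hc : Continuous (patternProj G) := (patternProj G).continuous_of_finiteDimensional
  have : ∀ i j, ∀ᶠ B in 𝓝 A, G.Adj i j → patternProj G B i j ≠ 0 := fun i j => by
    by_cases h : G.Adj i j
    · have hij : Continuous fun B => patternProj G B i j := hc.matrix_elem i j
      have := hij.continuousAt.eventually_ne (x := A) (y := 0)
        (by rw [hA.patternProj_eq]; exact (hA.2 i j h.ne).2 h)
      exact this.mono fun B hB _ => hB
    · exact .of_forall fun B h' => absurd h' h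
  filter_upwards [eventually_all.2 fun i => eventually_all.2 (this i)] with B hB
  refine ⟨patternProj_isSymm G B, fun i j hne => ⟨fun h => ?_, hB i j⟩⟩
  by_contra hadj
  exact h (patternProj_apply_of_not (by tauto) B)

theorem eventually_hasSSP {G : SimpleGraph (Fin n)} {A : Matrix (Fin n) (Fin n) ℝ}
    (hA : sMem G A) (hssp : HasSSP A) : ∀ᶠ B in 𝓝 A, sMem G B → HasSSP B := by
  have hiff : ∀ {B}, sMem G B → (HasSSP B ↔ ∀ X, B * X = X * B →
      subTranspose.prod (patternProj G) X = 0 → X = 0) := fun {B} hB => by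
    rw [hB.hasSSP_iff]
    simp [Matrix.IsSymm, sub_eq_zero, eq_comm (a := transpose _)]
  have hopen := isOpen_setOf_commute_imp_eq_zero
    (subTranspose.prod (patternProj G)).toContinuousLinearMap
  filter_upwards [hopen.mem_nhds ((hiff hA).1 hssp)] with B hB hBG
  exact (hiff hBG).2 hB

/-- Every symmetric matrix near `A` is orthogonally similar to a matrix in `S(G)` with the SSP. -/
theorem eventually_exists_charpoly_eq {G : SimpleGraph (Fin n)} {A : Matrix (Fin n) (Fin n) ℝ}
    (hA : sMem G A) (hssp : HasSSP A) :
    ∀ᶠ M in 𝓝 A, M.IsSymm → ∃ A', sMem G A' ∧ HasSSP A' ∧ A'.charpoly = M.charpoly := by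
  have hPA : patternProj G A = A := hA.patternProj_eq
  have hmap := map_nhds_exp_conj_add (patternProj G) subTranspose A hPA
    (by simp [hA.1.eq]) (hA.exists_of_hasSSP hssp)
  have hP : Tendsto (patternProj G) (𝓝 A) (𝓝 A) := by
    have := (patternProj G).continuous_of_finiteDimensional.tendsto A
    rwa [hPA] at this
  have hev : ∀ᶠ B in 𝓝 A, sMem G (patternProj G B) ∧ HasSSP (patternProj G B) := by
    filter_upwards [hP.eventually (eventually_hasSSP hA hssp), eventually_sMem hA] with B h1 h2
    exact ⟨h2, h1 h2⟩
  have hN := (continuous_fst.tendsto (A, (0 : Matrix (Fin n) (Fin n) ℝ))).eventually hev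
  have himg := image_mem_map (m := fun p => NormedSpace.exp (-subTranspose p.2) *
    patternProj G p.1 * NormedSpace.exp (subTranspose p.2) + subTranspose p.1) hN
  filter_upwards [hmap.ge himg]
  rintro _ ⟨⟨B, K⟩, ⟨h1, h2⟩, rfl⟩ hsymm
  refine ⟨_, h1, h2, ?_⟩
  dsimp only at hsymm ⊢
  have ht : ∀ B : Matrix (Fin n) (Fin n) ℝ, (subTranspose B)ᵀ = -subTranspose B := fun B => by
    simp
  have hB : subTranspose B = 0 := by
    have h := hsymm.eq
    rw [transpose_add, transpose_mul, transpose_mul, ← Matrix.exp_transpose,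
      ← Matrix.exp_transpose, transpose_neg, ht, ht, neg_neg, (patternProj_isSymm G B).eq,
      ← Matrix.mul_assoc, add_right_inj] at h
    ext i j
    have := congrFun₂ h i j
    rw [Matrix.neg_apply] at this
    rw [Matrix.zero_apply]
    linarith
  rw [hB, add_zero, charpoly_mul_comm, ← Matrix.mul_assoc, ← Matrix.exp_add_of_commute
    (subTranspose K) (-subTranspose K) (Commute.neg_right (Commute.refl _)), add_neg_cancel, NormedSpace.exp_zero, Matrix.one_mul]

end Helpers

/-- Corollary 5: if `A ∈ S(G)` has the SSP and eigenvalues `λ₁,…,λₙ` (with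
multiplicity), then every nearby list `μ₁,…,μₙ` is the spectrum of some matrix in
`S(G)` with the SSP. -/
theorem bifurcation_ssp_eigenvalues (n : ℕ) (G : SimpleGraph (Fin n))
    (A : Matrix (Fin n) (Fin n) ℝ) (hA : sMem G A) (hssp : HasSSP A)
    (lam : Fin n → ℝ) (hlam : A.charpoly = ∏ i, (X - C (lam i))) :
    ∃ ε > 0, ∀ mu : Fin n → ℝ, (∀ i, |mu i - lam i| < ε) →
      ∃ A' : Matrix (Fin n) (Fin n) ℝ,
        sMem G A' ∧ HasSSP A' ∧ A'.charpoly = ∏ i, (X - C (mu i)) := by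
  classical
  have hH : A.IsHermitian := by
    rw [Matrix.IsHermitian, conjTranspose_eq_transpose_of_trivial]; exact hA.1
  obtain ⟨σ, hσ⟩ := exists_perm_of_prod_X_sub_C_eq (b := hH.eigenvalues) (hlam.symm.trans hH.charpoly_eq)
  let U : Matrix (Fin n) (Fin n) ℝ := hH.eigenvectorUnitary
  let M : (Fin n → ℝ) → Matrix (Fin n) (Fin n) ℝ := fun mu => U * diagonal (mu ∘ σ) * Uᵀ
  have hUU : Uᵀ * U = 1 := by
    have := Unitary.star_mul_self_of_mem hH.eigenvectorUnitary.2
    rwa [star_eq_conjTranspose, conjTranspose_eq_transpose_of_trivial] at this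
  have hM : M lam = A := by
    conv_rhs => rw [hH.spectral_theorem]
    rw [Unitary.conjStarAlgAut_apply, hσ, star_eq_conjTranspose,
      conjTranspose_eq_transpose_of_trivial]
    rfl
  have hMc : Continuous M := by fun_prop
  have hev := (hMc.tendsto lam).eventually (hM ▸ eventually_exists_charpoly_eq hA hssp)
  obtain ⟨ε, hε, hball⟩ := Metric.eventually_nhds_iff.1 hev
  refine ⟨ε, hε, fun mu hmu => ?_⟩
  obtain ⟨A', h1, h2, h3⟩ := hball ((dist_pi_lt_iff hε).2 hmu) (by
    simp [M, Matrix.IsSymm, Matrix.mul_assoc])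
  refine ⟨A', h1, h2, ?_⟩
  rw [h3, charpoly_mul_comm, ← Matrix.mul_assoc, hUU, Matrix.one_mul, charpoly_diagonal]
  exact Equiv.prod_comp σ fun i => X - C (mu i)
end

section
/- Let G be a simple graph on n vertices and let A ∈ S(G) be a matrix with the strong multiplicity property (SMP) and ordered multiplicity list m(A) = m. Then for every refinement m' of m, there exists a matrix A' ∈ S(G) with the SMP and m(A') = m'. -/
open Matrix Polynomial

/-- The number of distinct (real) eigenvalues of `A`. -/
noncomputable def qDist {n : ℕ} (A : Matrix (Fin n) (Fin n) ℝ) : ℕ :=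
  A.charpoly.roots.toFinset.card

/-- The strong multiplicity property. -/
def HasSMP {n : ℕ} (A : Matrix (Fin n) (Fin n) ℝ) : Prop :=
  ∀ X : Matrix (Fin n) (Fin n) ℝ, X.IsSymm →
    (∀ i j, A i j * X i j = 0) → (∀ i, X i i = 0) → A * X = X * A →
    (∀ k < qDist A, Matrix.trace (A ^ k * X) = 0) → X = 0

/-- The ordered multiplicity list of `A`: the multiplicities of the distinct
eigenvalues of `A`, listed in increasing order of the eigenvalues. -/
noncomputable def omlist {n : ℕ} (A : Matrix (Fin n) (Fin n) ℝ) : List ℕ :=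
  (A.charpoly.roots.toFinset.sort (· ≤ ·)).map fun x => A.charpoly.roots.count x

/-- `m'` is a refinement of `m`: `m` is obtained by summing consecutive blocks of `m'`. -/
def IsRefinement (m' m : List ℕ) : Prop :=
  ∃ ls : List (List ℕ), ls.flatten = m' ∧ ls.map List.sum = m

open Filter Topology

attribute [local instance] Matrix.linftyOpNormedRing Matrix.linftyOpNormedAlgebra

/-- An indexed description of a multiset with increasing values determines its ordered list of
multiplicities. -/
theorem omlist_eq_of_roots {n : ℕ} (B : Matrix (Fin n) (Fin n) ℝ) (m : List ℕ)
    (hpos : ∀ x ∈ m, 0 < x) (w : Fin m.length → ℝ) (hw : StrictMono w)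
    (hB : B.charpoly.roots = ∑ j, Multiset.replicate (m.get j) (w j)) : omlist B = m := by
  have hcount : ∀ x, B.charpoly.roots.count x = ∑ j, if w j = x then m.get j else 0 := by
    intro x
    rw [hB, Multiset.count_sum']
    simp [Multiset.count_replicate]
  have hfin : B.charpoly.roots.toFinset = (List.ofFn w).toFinset := by
    ext x
    rw [Multiset.mem_toFinset, hB, Multiset.mem_sum]
    simp only [Multiset.mem_replicate, List.mem_toFinset, List.mem_ofFn, Finset.mem_univ, true_and]
    refine exists_congr fun j => ⟨fun h => h.2.symm, fun h => ⟨?_, h.symm⟩⟩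
    exact (hpos _ (List.get_mem m j)).ne'
  have hs : (List.ofFn w).SortedLT := hw.sortedLT_ofFn
  have hsort : B.charpoly.roots.toFinset.sort (· ≤ ·) = List.ofFn w := by
    rw [hfin]
    exact (List.toFinset_sort (· ≤ ·) hs.nodup).2 hs.sortedLE.pairwise
  unfold omlist
  rw [hsort, List.map_ofFn]
  conv_rhs => rw [← List.ofFn_get m]
  congr 1
  funext j
  simp [hcount, hw.injective.eq_iff]

/-- Spreading a sorted list of values along a list of blocks. -/
theorem exists_sorted_spread {α : Type*} [Preorder α] (f : α → ℕ) (ls : List (List ℕ)) :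
    ∀ xs : List α, xs.Pairwise (· ≤ ·) → ls.map List.sum = xs.map f →
      ∃ vs : List α, vs.length = ls.flatten.length ∧ vs.Pairwise (· ≤ ·) ∧ (∀ v ∈ vs, v ∈ xs) ∧
        (List.zipWith Multiset.replicate ls.flatten vs).sum =
          (xs.map fun x => Multiset.replicate (f x) x).sum := by
  induction ls with
  | nil =>
    intro xs _ h
    have : xs = [] := by simpa using h.symm
    subst this
    exact ⟨[], by simp⟩
  | cons b ls ih =>
    rintro (_ | ⟨x, xs⟩) hs h
    · simp at h
    · simp only [List.map_cons, List.cons.injEq] at h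
      rw [List.pairwise_cons] at hs
      obtain ⟨vs, h1, h2, h3, h4⟩ := ih xs hs.2 h.2
      refine ⟨List.replicate b.length x ++ vs, by simp [h1], ?_, ?_, ?_⟩
      · rw [List.pairwise_append]
        refine ⟨List.pairwise_replicate.2 (Or.inr le_rfl), h2, fun a ha c hc => ?_⟩
        rw [(List.mem_replicate.1 ha).2]
        exact hs.1 _ (h3 _ hc)
      · intro v hv
        rcases List.mem_append.1 hv with hv | hv
        · simp [(List.mem_replicate.1 hv).2]
        · exact List.mem_cons_of_mem _ (h3 _ hv)
      · have hb : (List.zipWith Multiset.replicate b (List.replicate b.length x)).sum =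
            Multiset.replicate b.sum x := by
          clear h
          induction b with
          | nil => simp
          | cons k b ihb => simp [List.replicate_succ, ihb, Multiset.replicate_add]
        rw [List.flatten_cons, List.zipWith_append (by simp), List.sum_append, hb, h4,
          List.map_cons, List.sum_cons, h.1]

/-- The roots of the characteristic polynomial grouped along a refinement of the ordered
multiplicity list. -/
theorem exists_monotone_roots_eq {n : ℕ} (A : Matrix (Fin n) (Fin n) ℝ) (m' : List ℕ)
    (href : IsRefinement m' (omlist A)) :
    ∃ v : Fin m'.length → ℝ, Monotone v ∧
      A.charpoly.roots = ∑ j, Multiset.replicate (m'.get j) (v j) := by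
  obtain ⟨ls, rfl, hls⟩ := href
  obtain ⟨vs, h1, h2, -, h4⟩ := exists_sorted_spread (fun x => A.charpoly.roots.count x) ls
    (A.charpoly.roots.toFinset.sort (· ≤ ·)) (Finset.pairwise_sort _ _) hls
  refine ⟨fun j => vs.get (j.cast h1.symm), fun i j hij => ?_, ?_⟩
  · exact (List.Pairwise.sortedLE h2).monotone_get (by simpa using hij)
  · have key : List.zipWith Multiset.replicate ls.flatten vs =
        List.ofFn fun j : Fin ls.flatten.length =>
          Multiset.replicate (ls.flatten.get j) (vs.get (j.cast h1.symm)) := by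
      apply List.ext_get
      · simp [h1]
      · intro k _ _
        simp
    rw [key, List.sum_ofFn] at h4
    rw [h4, ← List.sum_toFinset _ (Finset.sort_nodup _ _), Finset.sort_toFinset]
    conv_lhs => rw [← Multiset.toFinset_sum_count_nsmul_eq A.charpoly.roots]
    simp [Multiset.nsmul_singleton]

/-- A multiset of cardinality `n` is the family of values of a function on `Fin n`. -/
theorem Multiset.exists_map_univ_fin_eq {α : Type*} {n : ℕ} (s : Multiset α)
    (hs : Multiset.card s = n) : ∃ f : Fin n → α, Finset.univ.val.map f = s := by
  subst hs
  induction s using Quotient.inductionOn with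
  | h l => exact ⟨l.get, (Fin.univ_val_map l.get).trans (congrArg _ (List.ofFn_get l))⟩

/-- Two families with the same multiset of values differ by a permutation. -/
theorem exists_perm_of_map_univ_eq {α : Type*} [LinearOrder α] {n : ℕ} (f g : Fin n → α)
    (h : Finset.univ.val.map f = Finset.univ.val.map g) : ∃ σ : Equiv.Perm (Fin n), f = g ∘ σ := by
  rw [Fin.univ_val_map, Fin.univ_val_map, Multiset.coe_eq_coe] at h
  have key : f ∘ Tuple.sort f = g ∘ Tuple.sort g :=
    List.ofFn_injective <|
      ((((Tuple.sort f).ofFn_comp_perm f).trans h).trans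
        ((Tuple.sort g).ofFn_comp_perm g).symm).eq_of_pairwise'
        (Tuple.monotone_sort f).sortedLE_ofFn.pairwise (Tuple.monotone_sort g).sortedLE_ofFn.pairwise
  refine ⟨(Tuple.sort f).symm.trans (Tuple.sort g), funext fun i => ?_⟩
  simpa using congrFun key ((Tuple.sort f).symm i)

/-- A family whose values have prescribed multiplicities factors through the index set of the
values, compatibly with any reassignment of the values. -/
theorem exists_index_of_roots {n : ℕ} (l : Fin n → ℝ) (m : List ℕ) (v : Fin m.length → ℝ)
    (h : Finset.univ.val.map l = ∑ j, Multiset.replicate (m.get j) (v j)) :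
    ∃ t : Fin n → Fin m.length, (∀ i, l i = v (t i)) ∧
      ∀ w : Fin m.length → ℝ,
        Finset.univ.val.map (w ∘ t) = ∑ j, Multiset.replicate (m.get j) (w j) := by
  have hmap : ∀ w : Fin m.length → ℝ, (∑ j, Multiset.replicate (m.get j) j).map w =
      ∑ j, Multiset.replicate (m.get j) (w j) := by
    intro w
    rw [← Multiset.coe_mapAddMonoidHom, map_sum]
    simp
  have hc : Multiset.card (∑ j, Multiset.replicate (m.get j) j) = n := by
    have := congrArg Multiset.card h
    rw [← hmap] at this
    simpa using this.symm
  obtain ⟨t, ht⟩ := Multiset.exists_map_univ_fin_eq _ hc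
  have h' : Finset.univ.val.map l = Finset.univ.val.map (v ∘ t) := by
    rw [h, ← hmap, ← ht, Multiset.map_map]
  obtain ⟨σ, hσ⟩ := exists_perm_of_map_univ_eq _ _ h'
  refine ⟨t ∘ σ, fun i => by simp [hσ], fun w => ?_⟩
  rw [← hmap, ← ht, Multiset.map_map, ← Function.comp_assoc, ← Multiset.map_map]
  congr 1
  simp

/-- The first order expansion at the origin of the similarity equation obtained from
the Cayley transform of `k`. -/
theorem exists_hasStrictFDerivAt_cayley {V R : Type*} [NormedAddCommGroup V] [NormedSpace ℝ V]
    [NormedRing R] [NormedAlgebra ℝ R] (A E : R) (e : V →L[ℝ] ℝ) (b k p s : V →L[ℝ] R) :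
    ∃ L : V →L[ℝ] R, (∀ x, L x = b x + (2 : ℝ) • (A * k x - k x * A) - e x • E - p x + s x) ∧
      HasStrictFDerivAt (fun x => (1 - k x) * (A + b x) * (1 + k x) -
        (1 + k x) * (A + e x • E + p x) * (1 - k x) + s x) L 0 := by
  have he := e.hasStrictFDerivAt (x := 0)
  have hb := b.hasStrictFDerivAt (x := 0)
  have hk := k.hasStrictFDerivAt (x := 0)
  have hp := p.hasStrictFDerivAt (x := 0)
  have hs := s.hasStrictFDerivAt (x := 0)
  have h1 := hk.const_sub 1
  have h2 := hk.const_add 1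
  have h3 := hb.const_add A
  have h4 := ((he.smul_const E).const_add A).add hp
  refine ⟨_, fun x => ?_, ((((h1.mul' h3).mul' h2).sub ((h2.mul' h4).mul' h1)).add hs)⟩
  simp
  module

/-- Matrices intertwined by a Cayley transform have the same characteristic polynomial. -/
theorem charpoly_eq_of_cayley {n : ℕ} (K B C : Matrix (Fin n) (Fin n) ℝ)
    (h1 : (1 - K).det ≠ 0) (h2 : (1 + K).det ≠ 0)
    (h : (1 - K) * B * (1 + K) = (1 + K) * C * (1 - K)) : B.charpoly = C.charpoly := by
  have u1 : IsUnit (1 - K).det := h1.isUnit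
  have u2 : IsUnit (1 + K).det := h2.isUnit
  have hcomm : (1 - K) * (1 + K) = (1 + K) * (1 - K) := by noncomm_ring
  have hB : B = (1 - K)⁻¹ * ((1 + K) * C * (1 - K)) * (1 + K)⁻¹ := by
    rw [← h, Matrix.mul_assoc, Matrix.mul_assoc, Matrix.mul_assoc, Matrix.mul_nonsing_inv _ u2,
      Matrix.mul_one, ← Matrix.mul_assoc, Matrix.nonsing_inv_mul _ u1, Matrix.one_mul]
  have hone : (1 - K) * (1 + K)⁻¹ * ((1 - K)⁻¹ * (1 + K)) = 1 := by
    have : (1 + K)⁻¹ * (1 - K)⁻¹ = (1 - K)⁻¹ * (1 + K)⁻¹ := by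
      rw [← Matrix.mul_inv_rev, hcomm, Matrix.mul_inv_rev]
    calc (1 - K) * (1 + K)⁻¹ * ((1 - K)⁻¹ * (1 + K))
        = (1 - K) * ((1 + K)⁻¹ * (1 - K)⁻¹) * (1 + K) := by simp only [Matrix.mul_assoc]
      _ = ((1 - K) * (1 - K)⁻¹) * ((1 + K)⁻¹ * (1 + K)) := by rw [this]; simp only [Matrix.mul_assoc]
      _ = 1 := by rw [Matrix.mul_nonsing_inv _ u1, Matrix.nonsing_inv_mul _ u2, Matrix.one_mul]
  calc B.charpoly = (((1 - K)⁻¹ * (1 + K)) * (C * ((1 - K) * (1 + K)⁻¹))).charpoly := by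
        conv_lhs => rw [hB]
        simp only [Matrix.mul_assoc]
    _ = (C * ((1 - K) * (1 + K)⁻¹ * ((1 - K)⁻¹ * (1 + K)))).charpoly := by
        rw [Matrix.charpoly_mul_comm]
        simp only [Matrix.mul_assoc]
    _ = C.charpoly := by rw [hone, Matrix.mul_one]

/-- The strong multiplicity conditions stay non-degenerate under small perturbations. -/
theorem HasSMP.eventually {n : ℕ} {A : Matrix (Fin n) (Fin n) ℝ} (hA : HasSMP A) :
    ∀ᶠ B in 𝓝 A, ∀ X : Matrix (Fin n) (Fin n) ℝ, X.IsSymm → (∀ i j, A i j * X i j = 0) →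
      (∀ i, X i i = 0) → B * X = X * B → (∀ k < qDist A, Matrix.trace (B ^ k * X) = 0) → X = 0 := by
  have : ProperSpace (Matrix (Fin n) (Fin n) ℝ) := FiniteDimensional.proper ℝ _
  let S : Set (Matrix (Fin n) (Fin n) ℝ × Matrix (Fin n) (Fin n) ℝ) :=
    {z | z.2.IsSymm ∧ (∀ i j, A i j * z.2 i j = 0) ∧ (∀ i, z.2 i i = 0) ∧ z.1 * z.2 = z.2 * z.1 ∧
      ∀ k < qDist A, Matrix.trace (z.1 ^ k * z.2) = 0}
  have hS : IsClosed S := by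
    have c1 : IsClosed {z : Matrix (Fin n) (Fin n) ℝ × Matrix (Fin n) (Fin n) ℝ | z.2.IsSymm} :=
      isClosed_eq (by fun_prop) (by fun_prop)
    have c2 : IsClosed {z : Matrix (Fin n) (Fin n) ℝ × Matrix (Fin n) (Fin n) ℝ |
        ∀ i j, A i j * z.2 i j = 0} := by
      simp only [Set.ofPred_forall]
      exact isClosed_iInter fun i => isClosed_iInter fun j =>
        isClosed_eq (by fun_prop) (by fun_prop)
    have c3 : IsClosed {z : Matrix (Fin n) (Fin n) ℝ × Matrix (Fin n) (Fin n) ℝ |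
        ∀ i, z.2 i i = 0} := by
      simp only [Set.ofPred_forall]
      exact isClosed_iInter fun i => isClosed_eq (by fun_prop) (by fun_prop)
    have c4 : IsClosed {z : Matrix (Fin n) (Fin n) ℝ × Matrix (Fin n) (Fin n) ℝ |
        z.1 * z.2 = z.2 * z.1} := isClosed_eq (by fun_prop) (by fun_prop)
    have c5 : IsClosed {z : Matrix (Fin n) (Fin n) ℝ × Matrix (Fin n) (Fin n) ℝ |
        ∀ k < qDist A, Matrix.trace (z.1 ^ k * z.2) = 0} := by
      simp only [Set.ofPred_forall]
      exact isClosed_iInter fun k => isClosed_iInter fun _ =>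
        isClosed_eq (by fun_prop) (by fun_prop)
    exact c1.inter (c2.inter (c3.inter (c4.inter c5)))
  have hK : IsCompact (Metric.sphere (0 : Matrix (Fin n) (Fin n) ℝ) 1) := isCompact_sphere _ _
  have key : ∀ᶠ B in 𝓝 A, ∀ X ∈ Metric.sphere (0 : Matrix (Fin n) (Fin n) ℝ) 1, (B, X) ∉ S := by
    refine hK.eventually_forall_of_forall_eventually fun X hX => ?_
    refine hS.isOpen_compl.mem_nhds fun hmem => ?_
    have : X = 0 := hA X hmem.1 hmem.2.1 hmem.2.2.1 hmem.2.2.2.1 hmem.2.2.2.2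
    simp [this] at hX
  filter_upwards [key] with B hB X h1 h2 h3 h4 h5
  by_contra hX
  refine hB (‖X‖⁻¹ • X) (by simp [norm_smul, hX]) ⟨?_, ?_, ?_, ?_, ?_⟩
  · exact h1.smul _
  · intro i j
    simp only [Matrix.smul_apply, smul_eq_mul]
    rw [mul_left_comm, h2, mul_zero]
  · intro i
    simp [h3]
  · simp [h4]
  · intro k hk
    simp [h5 k hk]

/-- The directions preserving the zero pattern of `A`. -/
noncomputable def patternMap {n : ℕ} (A : Matrix (Fin n) (Fin n) ℝ) :
    Matrix (Fin n) (Fin n) ℝ →ₗ[ℝ] Matrix (Fin n) (Fin n) ℝ := by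
  classical exact
  { toFun := fun M => Matrix.of fun i j => if A i j ≠ 0 ∨ i = j then M i j + M j i else 0
    map_add' := fun M N => by
      ext i j
      by_cases h : A i j ≠ 0 ∨ i = j <;> simp [h]
      ring
    map_smul' := fun c M => by
      ext i j
      by_cases h : A i j ≠ 0 ∨ i = j <;> simp [h]
      ring }

theorem patternMap_apply_of_pos {n : ℕ} {A : Matrix (Fin n) (Fin n) ℝ} {i j : Fin n}
    (h : A i j ≠ 0 ∨ i = j) (M : Matrix (Fin n) (Fin n) ℝ) :
    patternMap A M i j = M i j + M j i := by
  simp [patternMap, h]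

theorem patternMap_apply_of_neg {n : ℕ} {A : Matrix (Fin n) (Fin n) ℝ} {i j : Fin n}
    (h : ¬ (A i j ≠ 0 ∨ i = j)) (M : Matrix (Fin n) (Fin n) ℝ) :
    patternMap A M i j = 0 := by
  simp [patternMap, h]

theorem patternMap_isSymm {n : ℕ} {A : Matrix (Fin n) (Fin n) ℝ} (hA : A.IsSymm)
    (M : Matrix (Fin n) (Fin n) ℝ) : (patternMap A M).IsSymm := by
  ext i j
  rw [Matrix.transpose_apply]
  by_cases h : A i j ≠ 0 ∨ i = j
  · have h' : A j i ≠ 0 ∨ j = i := by rw [hA.apply]; exact h.imp_right Eq.symm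
    rw [patternMap_apply_of_pos h, patternMap_apply_of_pos h', add_comm]
  · have h' : ¬ (A j i ≠ 0 ∨ j = i) := fun h' => h (by rw [← hA.apply]; exact h'.imp_right Eq.symm)
    rw [patternMap_apply_of_neg h, patternMap_apply_of_neg h']

/-- The skew-symmetric part of a matrix, doubled. -/
noncomputable def skewMap (n : ℕ) :
    Matrix (Fin n) (Fin n) ℝ →ₗ[ℝ] Matrix (Fin n) (Fin n) ℝ :=
  LinearMap.id - (Matrix.transposeLinearEquiv (Fin n) (Fin n) ℝ ℝ).toLinearMap

@[simp]
theorem skewMap_apply {n : ℕ} (M : Matrix (Fin n) (Fin n) ℝ) : skewMap n M = M - Mᵀ := rfl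

/-- Linear functionals on matrices are trace forms. -/
theorem exists_trace_mul_eq {n : ℕ} (φ : Matrix (Fin n) (Fin n) ℝ →ₗ[ℝ] ℝ) :
    ∃ W : Matrix (Fin n) (Fin n) ℝ, ∀ Y, φ Y = (W * Y).trace := by
  refine ⟨Matrix.of fun i j => φ (Matrix.single j i 1), fun Y => ?_⟩
  conv_lhs => rw [Matrix.matrix_eq_sum_single Y]
  simp only [map_sum, Matrix.trace, Matrix.diag, Matrix.mul_apply, Matrix.of_apply]
  rw [Finset.sum_comm]
  refine Finset.sum_congr rfl fun i _ => Finset.sum_congr rfl fun j _ => ?_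
  rw [mul_comm, ← smul_eq_mul, ← map_smul]
  simp

/-- The strong multiplicity property expressed as a transversality statement. -/
theorem HasSMP.exists_eq {n : ℕ} {A : Matrix (Fin n) (Fin n) ℝ} (hA : A.IsSymm) (hsmp : HasSMP A)
    (Y : Matrix (Fin n) (Fin n) ℝ) :
    ∃ (M N Z : Matrix (Fin n) (Fin n) ℝ) (c : Fin (qDist A) → ℝ),
      patternMap A M + (2 : ℝ) • (A * skewMap n N - skewMap n N * A) - ∑ k, c k • A ^ (k : ℕ) +
        skewMap n Z = Y := by
  let adA : Matrix (Fin n) (Fin n) ℝ →ₗ[ℝ] Matrix (Fin n) (Fin n) ℝ :=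
    LinearMap.mulLeft ℝ A - LinearMap.mulRight ℝ A
  let T : Submodule ℝ (Matrix (Fin n) (Fin n) ℝ) :=
    LinearMap.range (patternMap A) ⊔ LinearMap.range (adA ∘ₗ skewMap n) ⊔
      LinearMap.range (Fintype.linearCombination ℝ fun k : Fin (qDist A) => A ^ (k : ℕ)) ⊔
      LinearMap.range (skewMap n)
  have hT : T = ⊤ := by
    by_contra hne
    obtain ⟨φ, hφ, hle⟩ := Submodule.exists_le_ker_of_lt_top T (lt_top_iff_ne_top.2 hne)
    obtain ⟨W, hW⟩ := exists_trace_mul_eq φ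
    have hvan : ∀ Y ∈ T, (W * Y).trace = 0 := fun Y hY => by
      rw [← hW]; exact hle hY
    have g1 : ∀ M, (W * patternMap A M).trace = 0 := fun M => hvan _ <|
      Submodule.mem_sup_left <| Submodule.mem_sup_left <| Submodule.mem_sup_left ⟨M, rfl⟩
    have g2 : ∀ M, (W * adA (skewMap n M)).trace = 0 := fun M => hvan _ <|
      Submodule.mem_sup_left <| Submodule.mem_sup_left <| Submodule.mem_sup_right ⟨M, rfl⟩
    have g3 : ∀ k < qDist A, (W * A ^ k).trace = 0 := fun k hk => hvan _ <|
      Submodule.mem_sup_left <| Submodule.mem_sup_right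
        ⟨Pi.single ⟨k, hk⟩ 1, by simp [Fintype.linearCombination_apply_single]⟩
    have g4 : ∀ M, (W * skewMap n M).trace = 0 := fun M => hvan _ <|
      Submodule.mem_sup_right ⟨M, rfl⟩
    have hsymm : W.IsSymm := by
      ext i j
      have := g4 (Matrix.single i j 1)
      simpa [Matrix.mul_sub, Matrix.trace_mul_single, sub_eq_zero, eq_comm] using this
    have hpat : ∀ i j, A i j ≠ 0 ∨ i = j → W i j = 0 := by
      intro i j h
      have hP : patternMap A (Matrix.single i j 1) = Matrix.single i j 1 + Matrix.single j i 1 := by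
        have h' : A j i ≠ 0 ∨ j = i := by rw [hA.apply]; exact h.imp_right Eq.symm
        ext a b
        by_cases hab : A a b ≠ 0 ∨ a = b
        · rw [patternMap_apply_of_pos hab, Matrix.add_apply]
          simp [Matrix.single_apply, and_comm]
        · rw [patternMap_apply_of_neg hab, Matrix.add_apply]
          rw [Matrix.single_apply_of_ne, Matrix.single_apply_of_ne, add_zero]
          · rintro ⟨rfl, rfl⟩; exact hab h'
          · rintro ⟨rfl, rfl⟩; exact hab h
      have := g1 (Matrix.single i j 1)
      rw [hP, Matrix.mul_add, Matrix.trace_add, Matrix.trace_mul_single, Matrix.trace_mul_single,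
        hsymm.apply] at this
      simpa using this
    have hcomm : A * W = W * A := by
      set J := W * A - A * W with hJ
      have hJT : Jᵀ = -J := by
        rw [hJ, Matrix.transpose_sub, Matrix.transpose_mul, Matrix.transpose_mul, hA.eq, hsymm.eq]
        abel
      have h2 := g2 J
      have h3 : (W * adA (skewMap n J)).trace = 2 * (J * J).trace := by
        have : skewMap n J = (2 : ℝ) • J := by rw [skewMap_apply, hJT]; module
        rw [this, map_smul, Matrix.mul_smul, Matrix.trace_smul, smul_eq_mul]
        congr 1
        change (W * (A * J - J * A)).trace = _
        rw [Matrix.mul_sub, Matrix.trace_sub, ← Matrix.mul_assoc, ← Matrix.mul_assoc,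
          Matrix.trace_mul_comm (W * J) A, ← Matrix.mul_assoc, ← Matrix.trace_sub,
          ← Matrix.sub_mul]
      have h4 : (Jᴴ * J).trace = 0 := by
        rw [Matrix.conjTranspose_eq_transpose_of_trivial, hJT, Matrix.neg_mul, Matrix.trace_neg]
        linarith
      have h5 : J = 0 := Matrix.trace_conjTranspose_mul_self_eq_zero_iff.1 h4
      exact (sub_eq_zero.1 h5).symm
    have hW0 : W = 0 := by
      refine hsmp W hsymm (fun i j => ?_) (fun i => hpat i i (Or.inr rfl)) hcomm fun k hk => ?_
      · by_cases h : A i j = 0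
        · simp [h]
        · simp [hpat i j (Or.inl h)]
      · rw [Matrix.trace_mul_comm]; exact g3 k hk
    exact hφ (LinearMap.ext fun Y => by simp [hW, hW0])
  have hY : Y ∈ T := hT ▸ Submodule.mem_top
  obtain ⟨_, h1, _, ⟨Z, rfl⟩, rfl⟩ := Submodule.mem_sup.1 hY
  obtain ⟨_, h2, _, ⟨c, rfl⟩, rfl⟩ := Submodule.mem_sup.1 h1
  obtain ⟨_, ⟨M, rfl⟩, _, ⟨N, rfl⟩, rfl⟩ := Submodule.mem_sup.1 h2
  refine ⟨M, (2⁻¹ : ℝ) • N, Z, -c, ?_⟩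
  have : adA (skewMap n N) = A * skewMap n N - skewMap n N * A := rfl
  rw [LinearMap.comp_apply, this, map_smul, Fintype.linearCombination_apply]
  simp only [Pi.neg_apply, neg_smul, Finset.sum_neg_distrib, Matrix.mul_smul, Matrix.smul_mul]
  module

/-- The two sides of the similarity equation for a Cayley transform are symmetric, so a
skew-symmetric defect vanishes. -/
theorem eq_of_cayley_add_skew_eq_zero {n : ℕ} {B C K S : Matrix (Fin n) (Fin n) ℝ}
    (hB : B.IsSymm) (hC : C.IsSymm) (hK : Kᵀ = -K) (hS : Sᵀ = -S)
    (h : (1 - K) * B * (1 + K) - (1 + K) * C * (1 - K) + S = 0) :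
    (1 - K) * B * (1 + K) = (1 + K) * C * (1 - K) := by
  have hT := congrArg Matrix.transpose h
  simp only [Matrix.transpose_add, Matrix.transpose_sub, Matrix.transpose_mul,
    Matrix.transpose_one, Matrix.transpose_zero, hK, hS, hB.eq, hC.eq, ← sub_eq_add_neg,
    sub_neg_eq_add, ← Matrix.mul_assoc] at hT
  have h2 : (2 : ℝ) • ((1 - K) * B * (1 + K) - (1 + K) * C * (1 - K)) = 0 := by
    rw [two_smul]
    nth_rewrite 1 [eq_neg_of_add_eq_zero_left h]
    rw [sub_eq_zero.1 hT]
    abel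
  exact sub_eq_zero.1 ((smul_eq_zero.1 h2).resolve_left two_ne_zero)

/-- Under the strong multiplicity property, arbitrarily small perturbations of the spectrum in a
given direction are realised, up to a small correction by a polynomial in `A`, by nearby matrices
with the same zero pattern. -/
theorem HasSMP.exists_perturbation {n : ℕ} {A : Matrix (Fin n) (Fin n) ℝ} (hA : A.IsSymm)
    (hsmp : HasSMP A) {E : Matrix (Fin n) (Fin n) ℝ} (hE : E.IsSymm)
    {P : ℝ × Matrix (Fin n) (Fin n) ℝ × (Fin (qDist A) → ℝ) → Prop}
    (hP : ∀ᶠ z in 𝓝 (0, A, 0), P z) :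
    ∃ ε > 0, ∃ B c, P (ε, B, c) ∧ B.IsSymm ∧ (∀ i j, i ≠ j → A i j = 0 → B i j = 0) ∧
      B.charpoly = (A + ε • E + ∑ k, c k • A ^ (k : ℕ)).charpoly := by
  let R := Matrix (Fin n) (Fin n) ℝ
  let V := ℝ × R × R × R × (Fin (qDist A) → ℝ)
  let e : V →L[ℝ] ℝ := ContinuousLinearMap.fst ℝ ℝ _
  let b : V →L[ℝ] R := LinearMap.toContinuousLinearMap
    (patternMap A ∘ₗ LinearMap.fst ℝ R _ ∘ₗ LinearMap.snd ℝ ℝ _)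
  let k : V →L[ℝ] R := LinearMap.toContinuousLinearMap
    (skewMap n ∘ₗ LinearMap.fst ℝ R _ ∘ₗ LinearMap.snd ℝ R _ ∘ₗ LinearMap.snd ℝ ℝ _)
  let s : V →L[ℝ] R := LinearMap.toContinuousLinearMap
    (skewMap n ∘ₗ LinearMap.fst ℝ R _ ∘ₗ LinearMap.snd ℝ R _ ∘ₗ LinearMap.snd ℝ R _ ∘ₗ
      LinearMap.snd ℝ ℝ _)
  let γ : V →L[ℝ] (Fin (qDist A) → ℝ) := LinearMap.toContinuousLinearMap
    (LinearMap.snd ℝ R _ ∘ₗ LinearMap.snd ℝ R _ ∘ₗ LinearMap.snd ℝ R _ ∘ₗ LinearMap.snd ℝ ℝ _)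
  let p : V →L[ℝ] R := LinearMap.toContinuousLinearMap
    (Fintype.linearCombination ℝ fun k : Fin (qDist A) => A ^ (k : ℕ)) ∘L γ
  have hp : ∀ x, p x = ∑ k, γ x k • A ^ (k : ℕ) := fun x =>
    Fintype.linearCombination_apply ℝ (fun k : Fin (qDist A) => A ^ (k : ℕ)) (γ x)
  obtain ⟨L, hL, hder⟩ := exists_hasStrictFDerivAt_cayley A E e b k p s
  set F : V → R := fun x => (1 - k x) * (A + b x) * (1 + k x) -
        (1 + k x) * (A + e x • E + p x) * (1 - k x) + s x with hF
  have hsurj : (e.prod L).range = ⊤ := by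
    rw [LinearMap.range_eq_top]
    rintro ⟨a, Y⟩
    obtain ⟨M, N, Z, c, h⟩ := hsmp.exists_eq hA (Y + a • E)
    refine ⟨(a, M, N, Z, c), Prod.ext rfl ?_⟩
    refine (hL (a, M, N, Z, c)).trans ?_
    change patternMap A M + (2 : ℝ) • (A * skewMap n N - skewMap n N * A) - a • E -
      ∑ k, c k • A ^ (k : ℕ) + skewMap n Z = Y
    rw [eq_sub_of_add_eq h.symm]
    abel
  have hmap : map (fun x => (e x, F x)) (𝓝 0) = 𝓝 (e 0, F 0) :=
    (e.hasStrictFDerivAt.prodMk hder).map_nhds_eq_of_surj hsurj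
  have hH0 : (e 0, F 0) = (0, 0) := by simp [hF]
  rw [hH0] at hmap
  have hcont : Tendsto (fun x => (e x, A + b x, γ x)) (𝓝 0) (𝓝 (0, A, 0)) := by
    have : Continuous fun x => (e x, A + b x, γ x) := by fun_prop
    simpa using this.tendsto 0
  have hdet1 : ∀ᶠ x in 𝓝 0, (1 - k x).det ≠ 0 := by
    have : Continuous fun x => (1 - k x).det := by fun_prop
    exact this.continuousAt.eventually_ne (by simp)
  have hdet2 : ∀ᶠ x in 𝓝 0, (1 + k x).det ≠ 0 := by
    have : Continuous fun x => (1 + k x).det := by fun_prop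
    exact this.continuousAt.eventually_ne (by simp)
  have hgood : ∀ᶠ y in 𝓝 ((0 : ℝ), (0 : R)), ∃ x, (e x, F x) = y ∧
      P (e x, A + b x, γ x) ∧ (1 - k x).det ≠ 0 ∧ (1 + k x).det ≠ 0 := by
    rw [← hmap, eventually_map]
    filter_upwards [hcont.eventually hP, hdet1, hdet2] with x h1 h2 h3
    exact ⟨x, rfl, h1, h2, h3⟩
  have hline : Tendsto (fun ε : ℝ => (ε, (0 : R))) (𝓝[>] 0) (𝓝 (0, 0)) :=
    ((Continuous.prodMk_left (0 : R)).tendsto (0 : ℝ)).mono_left nhdsWithin_le_nhds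
  obtain ⟨ε, ⟨x, hx, hPx, hx1, hx2⟩, hε⟩ :=
    ((hline.eventually hgood).and self_mem_nhdsWithin).exists
  obtain ⟨rfl, hFx⟩ := Prod.mk.inj hx
  have hkT : (k x)ᵀ = -k x := by
    change (skewMap n x.2.2.1)ᵀ = -skewMap n x.2.2.1
    simp
  have hsT : (s x)ᵀ = -s x := by
    change (skewMap n x.2.2.2.1)ᵀ = -skewMap n x.2.2.2.1
    simp
  have hbT : (b x).IsSymm := patternMap_isSymm hA x.2.1
  have hpT : (p x)ᵀ = p x := by
    rw [hp, Matrix.transpose_sum]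
    simp [hA.eq]
  have hBT : (A + b x).IsSymm := hA.add hbT
  have heq := eq_of_cayley_add_skew_eq_zero hBT
    (show (A + e x • E + p x).IsSymm from (hA.add (hE.smul _)).add hpT) hkT hsT hFx
  refine ⟨e x, hε, A + b x, γ x, hPx, hBT, fun i j hij hAij => ?_, ?_⟩
  · rw [Matrix.add_apply, hAij, zero_add]
    exact patternMap_apply_of_neg (by simp [hAij, hij]) x.2.1
  · rw [charpoly_eq_of_cayley _ _ _ hx1 hx2 heq, hp]

theorem qDist_eq_length_omlist {n : ℕ} (A : Matrix (Fin n) (Fin n) ℝ) :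
    qDist A = (omlist A).length := by
  simp [qDist, omlist]

theorem IsRefinement.length_le {m' m : List ℕ} (h : IsRefinement m' m) (hm : ∀ x ∈ m, 0 < x) :
    m.length ≤ m'.length := by
  obtain ⟨ls, rfl, rfl⟩ := h
  induction ls with
  | nil => simp
  | cons b ls ih =>
    simp only [List.map_cons, List.mem_cons, forall_eq_or_imp] at hm
    have hb : 0 < b.length := List.length_pos_iff.2 fun h => by simp [h] at hm
    have := ih hm.2
    simp only [List.map_cons, List.length_cons, List.flatten_cons, List.length_append]
    omega

theorem pos_of_mem_omlist {n : ℕ} {A : Matrix (Fin n) (Fin n) ℝ} {x : ℕ} (hx : x ∈ omlist A) :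
    0 < x := by
  obtain ⟨y, hy, rfl⟩ := List.mem_map.1 hx
  rw [Finset.mem_sort, Multiset.mem_toFinset] at hy
  exact Multiset.count_pos.2 hy

/-- Simultaneously diagonal perturbations of a symmetric matrix. -/
theorem exists_diagonal_direction {n : ℕ} {A : Matrix (Fin n) (Fin n) ℝ} (hA : A.IsHermitian)
    (d : Fin n → ℝ) :
    ∃ E : Matrix (Fin n) (Fin n) ℝ, E.IsSymm ∧ ∀ (ε : ℝ) (q : ℕ) (c : Fin q → ℝ),
      (A + ε • E + ∑ k, c k • A ^ (k : ℕ)).charpoly.roots = Finset.univ.val.map fun i =>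
        hA.eigenvalues i + ε * d i + ∑ k, c k * hA.eigenvalues i ^ (k : ℕ) := by
  set φ := Unitary.conjStarAlgAut ℝ _ hA.eigenvectorUnitary with hφ
  have hAφ : A = φ (Matrix.diagonal hA.eigenvalues) := hA.spectral_theorem
  refine ⟨φ (Matrix.diagonal d), ?_, fun ε q c => ?_⟩
  · have : star (φ (Matrix.diagonal d)) = φ (Matrix.diagonal d) := by
      rw [← map_star, Matrix.star_eq_conjTranspose, Matrix.diagonal_conjTranspose]
      simp
    rwa [Matrix.star_eq_conjTranspose, Matrix.conjTranspose_eq_transpose_of_trivial] at this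
  · have h1 : A + ε • φ (Matrix.diagonal d) + ∑ k, c k • A ^ (k : ℕ) =
        φ (Matrix.diagonal fun i =>
          hA.eigenvalues i + ε * d i + ∑ k, c k * hA.eigenvalues i ^ (k : ℕ)) := by
      have h2 : (Matrix.diagonal fun i =>
          hA.eigenvalues i + ε * d i + ∑ k, c k * hA.eigenvalues i ^ (k : ℕ)) =
          Matrix.diagonal hA.eigenvalues + ε • Matrix.diagonal d +
            ∑ k, c k • Matrix.diagonal hA.eigenvalues ^ (k : ℕ) := by
        ext i j
        by_cases hij : i = j
        · subst hij
          simp [Matrix.diagonal_pow, Matrix.sum_apply]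
        · simp [Matrix.diagonal_pow, Matrix.sum_apply, hij]
      rw [h2]
      simp only [map_add, map_smul, map_sum, map_pow, ← hAφ]
    rw [h1, hφ, Unitary.conjStarAlgAut_apply, Matrix.charpoly_mul_comm, ← Matrix.mul_assoc]
    simp only [Unitary.coe_star_mul_self, Matrix.one_mul, Matrix.charpoly_diagonal]
    have := Polynomial.roots_multiset_prod_X_sub_C (Finset.univ.val.map fun i =>
      hA.eigenvalues i + ε * d i + ∑ k, c k * hA.eigenvalues i ^ (k : ℕ))
    rwa [Multiset.map_map] at this

/-- Corollary 6: if `A ∈ S(G)` has the SMP, then every refinement of the ordered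
multiplicity list of `A` is realized by a matrix in `S(G)` with the SMP. -/
theorem bifurcation_smp_refinement (n : ℕ) (G : SimpleGraph (Fin n))
    (A : Matrix (Fin n) (Fin n) ℝ) (hA : sMem G A) (hsmp : HasSMP A)
    (m' : List ℕ) (hpos : ∀ x ∈ m', 0 < x) (href : IsRefinement m' (omlist A)) :
    ∃ A' : Matrix (Fin n) (Fin n) ℝ,
      sMem G A' ∧ HasSMP A' ∧ omlist A' = m' := by
  have hH : A.IsHermitian := by
    rw [Matrix.IsHermitian, Matrix.conjTranspose_eq_transpose_of_trivial, hA.1.eq]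
  obtain ⟨v, hv, hroots⟩ := exists_monotone_roots_eq A m' href
  have hroots' : Finset.univ.val.map hH.eigenvalues =
      ∑ j, Multiset.replicate (m'.get j) (v j) := by
    rw [← hroots, hH.roots_charpoly_eq_eigenvalues]
    rfl
  obtain ⟨t, ht, hmap⟩ := exists_index_of_roots hH.eigenvalues m' v hroots'
  obtain ⟨E, hE, hchar⟩ := exists_diagonal_direction hH fun i => ((t i : ℕ) : ℝ)
  let w : ℝ → (Fin (qDist A) → ℝ) → Fin m'.length → ℝ := fun ε c j =>
    v j + ε * ((j : ℕ) : ℝ) + ∑ k, c k * v j ^ (k : ℕ)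
  have hcontB : ContinuousAt (fun z : ℝ × Matrix (Fin n) (Fin n) ℝ × (Fin (qDist A) → ℝ) =>
      z.2.1) (0, A, 0) := by fun_prop
  have e1 : ∀ᶠ z : ℝ × Matrix (Fin n) (Fin n) ℝ × (Fin (qDist A) → ℝ) in 𝓝 (0, A, 0),
      ∀ i j, A i j ≠ 0 → z.2.1 i j ≠ 0 := by
    refine eventually_all.2 fun i => eventually_all.2 fun j => ?_
    by_cases h : A i j = 0
    · simp [h]
    · have : ContinuousAt (fun z : ℝ × Matrix (Fin n) (Fin n) ℝ × (Fin (qDist A) → ℝ) =>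
        z.2.1 i j) (0, A, 0) := by fun_prop
      filter_upwards [this.eventually_ne h] with z hz _ using hz
  have e2 := hcontB.eventually hsmp.eventually
  have e3 : ∀ᶠ z : ℝ × Matrix (Fin n) (Fin n) ℝ × (Fin (qDist A) → ℝ) in 𝓝 (0, A, 0),
      ∀ i j, v i < v j → w z.1 z.2.2 i < w z.1 z.2.2 j := by
    refine eventually_all.2 fun i => eventually_all.2 fun j => ?_
    by_cases h : v i < v j
    · have hc : ∀ j, ContinuousAt (fun z : ℝ × Matrix (Fin n) (Fin n) ℝ × (Fin (qDist A) → ℝ) =>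
          w z.1 z.2.2 j) (0, A, 0) := fun j => by
        simp only [w]; fun_prop
      filter_upwards [(hc i).eventually_lt (hc j) (by simpa [w] using h)] with z hz _ using hz
    · simp [h]
  obtain ⟨ε, hε, B, c, ⟨p1, p2, p3⟩, hBs, hB0, hBchar⟩ :=
    hsmp.exists_perturbation hA.1 hE (e1.and (e2.and e3))
  have hw : StrictMono (w ε c) := by
    intro i j hij
    rcases (hv hij.le).lt_or_eq with h | h
    · exact p3 i j h
    · have : ((i : ℕ) : ℝ) < ((j : ℕ) : ℝ) := by exact_mod_cast hij
      simp only [w, h]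
      gcongr
  have hom : omlist B = m' := by
    refine omlist_eq_of_roots B m' hpos (w ε c) hw ?_
    rw [hBchar, hchar, ← hmap]
    refine Multiset.map_congr rfl fun i _ => ?_
    simp [w, ht]
  have hpattern : ∀ i j, i ≠ j → (B i j ≠ 0 ↔ A i j ≠ 0) := fun i j hij =>
    ⟨fun h h' => h (hB0 i j hij h'), p1 i j⟩
  refine ⟨B, ⟨hBs, fun i j hij => (hpattern i j hij).trans (hA.2 i j hij)⟩, ?_, hom⟩
  intro X h1 h2 h3 h4 h5
  have hq : qDist A ≤ qDist B := by
    rw [qDist_eq_length_omlist, qDist_eq_length_omlist, hom]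
    exact href.length_le fun x hx => pos_of_mem_omlist hx
  refine p2 X h1 (fun i j => ?_) h3 h4 fun k hk => h5 k (hk.trans_le hq)
  by_cases hij : i = j
  · subst hij
    simp [h3]
  · rcases mul_eq_zero.1 (h2 i j) with h | h
    · rw [not_not.1 (mt (hpattern i j hij).2 (not_not.2 h)), zero_mul]
    · rw [h, mul_zero]
end

section
/- Let G be a simple graph on n vertices and let A ∈ S(G) be a matrix with the strong Arnol'd property (SAP) such that pin(A) = (a, b) with a + b < n. Then there exist matrices A₁', A₂' ∈ S(G), both with the SAP, such that pin(A₁') = (a+1, b) and pin(A₂') = (a, b+1). -/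
open Matrix Polynomial

/-- The strong Arnol'd property. -/
def HasSAP {n : ℕ} (A : Matrix (Fin n) (Fin n) ℝ) : Prop :=
  ∀ X : Matrix (Fin n) (Fin n) ℝ, X.IsSymm →
    (∀ i j, A i j * X i j = 0) → (∀ i, X i i = 0) → A * X = 0 → X = 0

/-- The partial inertia of a real symmetric matrix: the number of positive
and negative eigenvalues, counted with multiplicity. -/
noncomputable def pin {n : ℕ} (A : Matrix (Fin n) (Fin n) ℝ) : ℕ × ℕ :=
  ((A.charpoly.roots.filter (fun x => 0 < x)).card,
   (A.charpoly.roots.filter (fun x => x < 0)).card)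

open Topology Filter

/-- Congruent matrices have isometric quadratic forms. -/
lemma Matrix.toQuadraticForm'_equivalent_of_congr {n : ℕ} {A P M : Matrix (Fin n) (Fin n) ℝ}
    (hP : IsUnit P.det) (h : Pᵀ * A * P = M) :
    QuadraticMap.Equivalent M.toQuadraticForm' A.toQuadraticForm' := by
  have hP' : IsUnit P := (Matrix.isUnit_iff_isUnit_det P).2 hP
  refine ⟨{ P.toLinearEquiv' hP'.invertible with map_app' := ?_ }⟩
  intro x
  have hx : (P.toLinearEquiv' hP'.invertible) x = P *ᵥ x := rfl
  change A.toQuadraticForm' ((P.toLinearEquiv' hP'.invertible) x) = _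
  rw [hx, ← h]
  simp only [Matrix.toQuadraticForm', LinearMap.BilinMap.toQuadraticMap_apply,
    Matrix.toLinearMap₂'_apply']
  rw [← Matrix.mulVec_mulVec, ← Matrix.mulVec_mulVec, Matrix.dotProduct_mulVec x,
    Matrix.vecMul_transpose]

lemma Matrix.toQuadraticForm'_diagonal {n : ℕ} (d : Fin n → ℝ) :
    (diagonal d).toQuadraticForm' = QuadraticMap.weightedSumSquares ℝ d := by
  ext x
  simp [Matrix.toQuadraticForm', Matrix.toLinearMap₂'_apply', Matrix.mulVec_diagonal, dotProduct,
    mul_left_comm]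

/-- A real symmetric matrix is congruent to a diagonal matrix whose entries count its partial
inertia. -/
lemma exists_congr_diagonal {n : ℕ} {A : Matrix (Fin n) (Fin n) ℝ} (hA : A.IsSymm) :
    ∃ (d : Fin n → ℝ) (P : Matrix (Fin n) (Fin n) ℝ), IsUnit P.det ∧ Pᵀ * diagonal d * P = A ∧
      pin A = ({i | 0 < d i}.ncard, {i | d i < 0}.ncard) := by
  have hH : A.IsHermitian := by
    rw [Matrix.IsHermitian, Matrix.conjTranspose_eq_transpose_of_trivial]; exact hA
  refine ⟨hH.eigenvalues, star (hH.eigenvectorUnitary : Matrix (Fin n) (Fin n) ℝ), ?_, ?_, ?_⟩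
  · rw [← Matrix.isUnit_iff_isUnit_det]
    exact (Unitary.toUnits (star hH.eigenvectorUnitary)).isUnit
  · conv_rhs => rw [hH.spectral_theorem]
    rw [Unitary.conjStarAlgAut_apply]
    simp [Matrix.star_eq_conjTranspose]
  · simp only [pin, hH.roots_charpoly_eq_eigenvalues, Multiset.filter_map, Multiset.card_map,
      Set.ncard_eq_toFinset_card', Set.toFinset_ofPred]
    rfl

lemma pin_eq_of_congr_diagonal {n : ℕ} {A P Q : Matrix (Fin n) (Fin n) ℝ} {d : Fin n → ℝ}
    (hA : A.IsSymm) (hP : IsUnit P.det) (hQ : IsUnit Q.det)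
    (h : Pᵀ * A * P = Qᵀ * diagonal d * Q) :
    pin A = ({i | 0 < d i}.ncard, {i | d i < 0}.ncard) := by
  obtain ⟨e, R, hR, hRA, hpin⟩ := exists_congr_diagonal hA
  have h₁ := Matrix.toQuadraticForm'_equivalent_of_congr hR hRA
  have h₂ := (Matrix.toQuadraticForm'_equivalent_of_congr hP h).symm.trans
    (Matrix.toQuadraticForm'_equivalent_of_congr hQ rfl)
  rw [Matrix.toQuadraticForm'_diagonal] at h₁ h₂
  rw [hpin, ← QuadraticForm.sigPos_of_equiv_weightedSumSquares h₁,
    ← QuadraticForm.sigNeg_of_equiv_weightedSumSquares h₁,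
    QuadraticForm.sigPos_of_equiv_weightedSumSquares h₂,
    QuadraticForm.sigNeg_of_equiv_weightedSumSquares h₂]

section Perturbation

open scoped Matrix.Norms.Operator

/-- The strong Arnol'd property is an open condition within `S(G)`. -/
lemma HasSAP.eventually {n : ℕ} {G : SimpleGraph (Fin n)} {A : Matrix (Fin n) (Fin n) ℝ}
    (hA : sMem G A) (hsap : HasSAP A) : ∀ᶠ A' in 𝓝 A, sMem G A' → HasSAP A' := by
  let K : Set (Matrix (Fin n) (Fin n) ℝ) := Metric.sphere 0 1 ∩
    {X | X.IsSymm ∧ ∀ i j, (i = j ∨ G.Adj i j) → X i j = 0}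
  have hclosed : IsClosed {X : Matrix (Fin n) (Fin n) ℝ |
      X.IsSymm ∧ ∀ i j, (i = j ∨ G.Adj i j) → X i j = 0} := by
    simp only [Set.ofPred_and, Set.ofPred_forall]
    refine (isClosed_eq (by fun_prop) continuous_id).inter ?_
    exact isClosed_iInter fun i => isClosed_iInter fun j => isClosed_iInter fun _ =>
      isClosed_eq (by fun_prop) continuous_const
  have hK : IsCompact K := (isCompact_sphere _ _).inter_right hclosed
  have hev : ∀ᶠ A' in 𝓝 A, ∀ X ∈ K, A' * X ≠ 0 := by
    refine hK.eventually_forall_of_forall_eventually fun X hX => ?_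
    have hc : Continuous fun z : Matrix (Fin n) (Fin n) ℝ × Matrix (Fin n) (Fin n) ℝ =>
      z.1 * z.2 := by fun_prop
    refine hc.continuousAt.eventually_ne fun h0 => ?_
    have hX0 : X = 0 := by
      refine hsap X hX.2.1 (fun i j => ?_) (fun i => hX.2.2 i i (.inl rfl)) h0
      by_cases hij : i = j ∨ G.Adj i j
      · rw [hX.2.2 i j hij, mul_zero]
      · push Not at hij
        rw [not_not.1 (mt (hA.2 i j hij.1).1 hij.2), zero_mul]
    simpa [hX0] using hX.1
  filter_upwards [hev] with A' hA' hmem X hX hXG hXd hAX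
  by_contra hne
  refine hA' (‖X‖⁻¹ • X) ⟨?_, hX.smul _, fun i j hij => ?_⟩ (by rw [mul_smul_comm, hAX, smul_zero])
  · simp [norm_smul, hne]
  · have : X i j = 0 := by
      by_cases h : i = j
      · exact h ▸ hXd i
      · exact (mul_eq_zero.1 (hXG i j)).resolve_left
          ((hmem.2 i j h).2 (hij.resolve_left h))
    simp [this]

/-- The symmetrized restriction of a matrix to the diagonal and the edges of `G`. -/
noncomputable def symmPattern {n : ℕ} (G : SimpleGraph (Fin n)) :
    Matrix (Fin n) (Fin n) ℝ →ₗ[ℝ] Matrix (Fin n) (Fin n) ℝ := by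
  classical
  exact
  { toFun B := Matrix.of fun i j => if i = j ∨ G.Adj i j then B i j + B j i else 0
    map_add' B C := by
      ext i j
      simp only [Matrix.of_apply, Matrix.add_apply]
      split_ifs <;> ring
    map_smul' c B := by
      ext i j
      simp [mul_add] }

lemma symmPattern_apply_of_mem {n : ℕ} {G : SimpleGraph (Fin n)} {i j : Fin n}
    (h : i = j ∨ G.Adj i j) (B : Matrix (Fin n) (Fin n) ℝ) :
    symmPattern G B i j = B i j + B j i := by
  simp [symmPattern, h]

lemma symmPattern_apply_of_notMem {n : ℕ} {G : SimpleGraph (Fin n)} {i j : Fin n}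
    (h : ¬ (i = j ∨ G.Adj i j)) (B : Matrix (Fin n) (Fin n) ℝ) :
    symmPattern G B i j = 0 := by
  simp [symmPattern, h]

lemma symmPattern_isSymm {n : ℕ} (G : SimpleGraph (Fin n)) (B : Matrix (Fin n) (Fin n) ℝ) :
    (symmPattern G B).IsSymm := by
  ext i j
  rw [Matrix.transpose_apply]
  by_cases h : i = j ∨ G.Adj i j
  · rw [symmPattern_apply_of_mem h, symmPattern_apply_of_mem (h.imp Eq.symm (·.symm)), add_comm]
  · rw [symmPattern_apply_of_notMem h,
      symmPattern_apply_of_notMem fun h' => h (h'.imp Eq.symm (·.symm))]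

/-- For `A ∈ S(G)` with the strong Arnol'd property, the congruence orbit of `A` meets `S(G)`
transversally at `A`. -/
lemma HasSAP.exists_eq_add {n : ℕ} {G : SimpleGraph (Fin n)} {A : Matrix (Fin n) (Fin n) ℝ}
    (hA : sMem G A) (hsap : HasSAP A) (M : Matrix (Fin n) (Fin n) ℝ) :
    ∃ K B : Matrix (Fin n) (Fin n) ℝ, Kᵀ * A + A * K + symmPattern G B + (B - Bᵀ) = M := by
  let T := Matrix.transposeLinearEquiv (Fin n) (Fin n) ℝ ℝ
  let L : Matrix (Fin n) (Fin n) ℝ × Matrix (Fin n) (Fin n) ℝ →ₗ[ℝ] Matrix (Fin n) (Fin n) ℝ :=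
    (LinearMap.mulRight ℝ A ∘ₗ T.toLinearMap + LinearMap.mulLeft ℝ A).coprod
      (symmPattern G + (LinearMap.id - T.toLinearMap))
  have hL : ∀ K B, L (K, B) = Kᵀ * A + A * K + symmPattern G B + (B - Bᵀ) := fun K B => by
    simp [L, T, add_assoc]
  suffices LinearMap.range L = ⊤ by
    obtain ⟨⟨K, B⟩, h⟩ := LinearMap.range_eq_top.1 this M
    exact ⟨K, B, by rw [← hL, h]⟩
  by_contra hne
  obtain ⟨f, hf, hle⟩ := Submodule.exists_le_ker_of_lt_top _ (lt_top_iff_ne_top.2 hne)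
  have hfL : ∀ K B, f (Kᵀ * A + A * K + symmPattern G B + (B - Bᵀ)) = 0 := fun K B => by
    rw [← hL]; exact hle ⟨_, rfl⟩
  let X : Matrix (Fin n) (Fin n) ℝ := Matrix.of fun i j => f (Matrix.single i j 1)
  have hfX : ∀ M, f M = ∑ i, ∑ j, M i j * X i j := fun M => by
    conv_lhs => rw [Matrix.matrix_eq_sum_single M]
    simp only [map_sum, X, Matrix.of_apply]
    refine Finset.sum_congr rfl fun i _ => Finset.sum_congr rfl fun j _ => ?_
    rw [← smul_eq_mul, ← map_smul, Matrix.smul_single, smul_eq_mul, mul_one]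
  have hX : X.IsSymm := by
    ext i j
    have h := hfL 0 (Matrix.single i j 1 - Matrix.single j i 1)
    have h0 : symmPattern G (Matrix.single i j 1 - Matrix.single j i 1) = 0 := by
      ext k l
      by_cases hkl : k = l ∨ G.Adj k l
      · rw [symmPattern_apply_of_mem hkl]
        simp only [Matrix.sub_apply, Matrix.single_apply, Matrix.zero_apply, and_comm]
        ring
      · rw [symmPattern_apply_of_notMem hkl, Matrix.zero_apply]
    rw [h0] at h
    simp only [Matrix.transpose_zero, zero_mul, mul_zero, add_zero, zero_add,
      Matrix.transpose_sub, Matrix.transpose_single, map_sub] at h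
    simp only [Matrix.transpose_apply, X, Matrix.of_apply]
    linarith
  have hfT : ∀ M, f Mᵀ = f M := fun M => by
    rw [hfX, hfX, Finset.sum_comm]
    refine Finset.sum_congr rfl fun i _ => Finset.sum_congr rfl fun j _ => ?_
    rw [Matrix.transpose_apply, hX.apply]
  have hXG : ∀ i j, (i = j ∨ G.Adj i j) → X i j = 0 := fun i j hij => by
    have h := hfL 0 (Matrix.single i j 1)
    have hs : symmPattern G (Matrix.single i j 1) = Matrix.single i j 1 + Matrix.single j i 1 := by
      ext k l
      by_cases hkl : k = l ∨ G.Adj k l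
      · rw [symmPattern_apply_of_mem hkl]
        simp only [Matrix.add_apply, Matrix.single_apply, and_comm]
      · rw [symmPattern_apply_of_notMem hkl]
        simp only [Matrix.add_apply, Matrix.single_apply]
        rw [if_neg, if_neg, add_zero]
        · rintro ⟨rfl, rfl⟩; exact hkl (hij.imp Eq.symm (·.symm))
        · rintro ⟨rfl, rfl⟩; exact hkl hij
    rw [hs] at h
    simp only [Matrix.transpose_zero, zero_mul, mul_zero, add_zero, zero_add,
      Matrix.transpose_single, map_sub, map_add] at h
    have hji := hX.apply i j
    simp only [X, Matrix.of_apply] at hji ⊢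
    linarith
  have hAX : A * X = 0 := by
    ext k j
    have h := hfL (Matrix.single k j 1) 0
    simp only [map_zero, Matrix.transpose_zero, sub_zero, add_zero, map_add] at h
    rw [← hfT ((Matrix.single k j 1)ᵀ * A), Matrix.transpose_mul, Matrix.transpose_transpose,
      hA.1.eq] at h
    have h' : f (A * Matrix.single k j 1) = (A * X) k j := by
      rw [hfX, Matrix.mul_apply]
      refine Finset.sum_congr rfl fun i _ => ?_
      rw [Finset.sum_eq_single j]
      · simp [hA.1.apply k i]
      · intro l _ hl
        simp [Matrix.mul_single_apply_of_ne (hbj := hl)]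
      · simp
    rw [Matrix.zero_apply]
    linarith
  have hX0 : X = 0 := by
    refine hsap X hX (fun i j => ?_) (fun i => hXG i i (.inl rfl)) hAX
    by_cases hij : i = j ∨ G.Adj i j
    · rw [hXG i j hij, mul_zero]
    · push Not at hij
      rw [not_not.1 (mt (hA.2 i j hij.1).1 hij.2), zero_mul]
  exact hf (LinearMap.ext fun M => by simp [hfX, hX0])

/-- Pairs of real square matrices. -/
abbrev MatrixPair (n : ℕ) := Matrix (Fin n) (Fin n) ℝ × Matrix (Fin n) (Fin n) ℝ

/-- If `A ∈ S(G)` has the strong Arnol'd property, then every symmetric matrix near `A` is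
congruent to a matrix in `S(G)` with the strong Arnol'd property. -/
lemma HasSAP.eventually_exists_congr {n : ℕ} {G : SimpleGraph (Fin n)}
    {A : Matrix (Fin n) (Fin n) ℝ} (hA : sMem G A) (hsap : HasSAP A) :
    ∀ᶠ M in 𝓝 A, M.IsSymm → ∃ A' P : Matrix (Fin n) (Fin n) ℝ,
      sMem G A' ∧ HasSAP A' ∧ IsUnit P.det ∧ Pᵀ * A' * P = M := by
  let T : Matrix (Fin n) (Fin n) ℝ →L[ℝ] Matrix (Fin n) (Fin n) ℝ :=
    (Matrix.transposeLinearEquiv (Fin n) (Fin n) ℝ ℝ).toLinearMap.toContinuousLinearMap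
  let S : Matrix (Fin n) (Fin n) ℝ →L[ℝ] Matrix (Fin n) (Fin n) ℝ :=
    (symmPattern G).toContinuousLinearMap
  let F : MatrixPair n → Matrix (Fin n) (Fin n) ℝ := fun p =>
    (1 + T p.1) * (A + S p.2) * (1 + p.1) + (p.2 - T p.2)
  have hT : ∀ M, T M = Mᵀ := fun _ => rfl
  have hS : ∀ M, S M = symmPattern G M := fun _ => rfl
  have hfst : HasStrictFDerivAt (fun p : MatrixPair n => p.1)
      (ContinuousLinearMap.fst ℝ _ _) 0 :=
    hasStrictFDerivAt_fst
  have hsnd : HasStrictFDerivAt (fun p : MatrixPair n => p.2)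
      (ContinuousLinearMap.snd ℝ _ _) 0 :=
    hasStrictFDerivAt_snd
  have hF := ((((T.hasStrictFDerivAt.comp (0 : MatrixPair n) hfst).const_add 1).mul'
    ((S.hasStrictFDerivAt.comp (0 : MatrixPair n) hsnd).const_add A)).mul'
      (hfst.const_add 1)).add
    (hsnd.sub (T.hasStrictFDerivAt.comp (0 : MatrixPair n) hsnd))
  have hmap := hF.map_nhds_eq_of_surj (by
    refine LinearMap.range_eq_top.2 fun M => ?_
    obtain ⟨K, B, h⟩ := hsap.exists_eq_add hA M
    refine ⟨(K, B), ?_⟩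
    rw [← h]
    change (1 + T 0) * (A + S 0) * K + ((1 + T 0) * S B + T K * (A + S 0)) * (1 + 0) +
      (B - T B) = _
    simp only [hT, hS, map_zero, Matrix.transpose_zero, add_zero, one_mul, mul_one]
    abel)
  have hF0 : F 0 = A := by simp [F]
  change map F (𝓝 0) = 𝓝 (F 0) at hmap
  rw [hF0] at hmap
  have hA' : Continuous fun p : MatrixPair n => A + S p.2 := by fun_prop
  have hA0 : A + S (0 : MatrixPair n).2 = A := by simp
  have hdet : ∀ᶠ p : MatrixPair n in 𝓝 0, (1 + p.1).det ≠ 0 := by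
    have hc : Continuous fun p : MatrixPair n => (1 + p.1).det := by fun_prop
    exact hc.continuousAt.eventually_ne (by simp)
  have hsap' : ∀ᶠ p : MatrixPair n in 𝓝 0, sMem G (A + S p.2) → HasSAP (A + S p.2) := by
    have := hA'.tendsto 0
    rw [hA0] at this
    exact this.eventually (hsap.eventually hA)
  have hmem : ∀ᶠ p : MatrixPair n in 𝓝 0,
      ∀ i j, G.Adj i j → (A + S p.2) i j ≠ 0 := by
    simp only [eventually_all]
    intro i j hij
    have hc : Continuous fun p : MatrixPair n => (A + S p.2) i j := hA'.matrix_elem i j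
    refine hc.continuousAt.eventually_ne ?_
    rw [hA0]
    exact (hA.2 i j hij.ne).2 hij
  rw [← hmap, eventually_map]
  filter_upwards [hdet, hsap', hmem] with p hp₁ hp₂ hp₃ hsymm
  have hB : (A + S p.2).IsSymm := hA.1.add (symmPattern_isSymm G p.2)
  have hG : sMem G (A + S p.2) := by
    refine ⟨hB, fun i j hij => ⟨fun h => ?_, hp₃ i j⟩⟩
    by_contra hadj
    refine h ?_
    rw [Matrix.add_apply, hS, symmPattern_apply_of_notMem (by tauto), add_zero]
    exact not_not.1 (mt (hA.2 i j hij).1 hadj)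
  refine ⟨A + S p.2, 1 + p.1, hG, hp₂ hG, hp₁.isUnit, ?_⟩
  have hFp : F p = (1 + p.1)ᵀ * (A + S p.2) * (1 + p.1) + (p.2 - p.2ᵀ) := by
    simp [F, hT]
  have hcongr : ((1 + p.1)ᵀ * (A + S p.2) * (1 + p.1)).IsSymm := by
    rw [Matrix.IsSymm, Matrix.transpose_mul, Matrix.transpose_mul, Matrix.transpose_transpose,
      hB.eq, mul_assoc]
  rw [hFp] at hsymm ⊢
  rw [Matrix.IsSymm, Matrix.transpose_add, hcongr.eq, add_right_inj, Matrix.transpose_sub,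
    Matrix.transpose_transpose] at hsymm
  have h0 : p.2 - p.2ᵀ = 0 := by
    ext i j
    have hij := congrFun₂ hsymm i j
    simp only [Matrix.sub_apply, Matrix.transpose_apply, Matrix.zero_apply] at hij ⊢
    linarith
  rw [h0, add_zero]

end Perturbation

/-- Corollary 7 (stable northeast lemma): if `A ∈ S(G)` has the SAP and partial
inertia `(a,b)` with `a + b < n`, then the partial inertias `(a+1,b)` and `(a,b+1)`
are realized by matrices in `S(G)` with the SAP. -/
theorem stable_northeast (n : ℕ) (G : SimpleGraph (Fin n))
    (A : Matrix (Fin n) (Fin n) ℝ) (hA : sMem G A) (hsap : HasSAP A)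
    (a b : ℕ) (hpin : pin A = (a, b)) (hab : a + b < n) :
    (∃ A₁ : Matrix (Fin n) (Fin n) ℝ, sMem G A₁ ∧ HasSAP A₁ ∧ pin A₁ = (a + 1, b)) ∧
    (∃ A₂ : Matrix (Fin n) (Fin n) ℝ, sMem G A₂ ∧ HasSAP A₂ ∧ pin A₂ = (a, b + 1)) := by
  obtain ⟨d, P, hP, hPA, hd⟩ := exists_congr_diagonal hA.1
  rw [hpin, Prod.mk.injEq] at hd
  obtain ⟨i, hi⟩ : ∃ i, d i = 0 := by
    by_contra! hne
    have hun : {i | 0 < d i} ∪ {i | d i < 0} = Set.univ :=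
      Set.eq_univ_of_forall fun i => (hne i).lt_or_gt.symm
    have hcard := Set.ncard_union_le {i | 0 < d i} {i | d i < 0}
    rw [hun, Set.ncard_univ, Nat.card_fin, ← hd.1, ← hd.2] at hcard
    omega
  have hcont : Continuous fun t : ℝ => Pᵀ * diagonal (Function.update d i t) * P := by
    fun_prop
  have hlim := hcont.tendsto 0
  rw [← hi, Function.update_eq_self, hPA, hi] at hlim
  have hev : ∀ᶠ t in 𝓝 (0 : ℝ), ∃ A' : Matrix (Fin n) (Fin n) ℝ, sMem G A' ∧ HasSAP A' ∧
      pin A' = ({j | 0 < Function.update d i t j}.ncard,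
        {j | Function.update d i t j < 0}.ncard) := by
    filter_upwards [hlim.eventually (hsap.eventually_exists_congr hA)] with t ht
    obtain ⟨A', Q, hG, hS, hQ, hQA⟩ := ht (by
      rw [Matrix.IsSymm, Matrix.transpose_mul, Matrix.transpose_mul, Matrix.transpose_transpose,
        Matrix.diagonal_transpose, mul_assoc])
    exact ⟨A', hG, hS, pin_eq_of_congr_diagonal hG.1 hQ hP hQA⟩
  constructor
  · obtain ⟨t, ⟨A', hG, hS, h⟩, ht⟩ :=
      ((hev.filter_mono nhdsWithin_le_nhds).and (self_mem_nhdsWithin (s := Set.Ioi 0))).exists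
    refine ⟨A', hG, hS, ?_⟩
    have hpos : {j | 0 < Function.update d i t j} = insert i {j | 0 < d j} := by
      ext j
      by_cases hj : j = i <;> simp_all
    have hneg : {j | Function.update d i t j < 0} = {j | d j < 0} := by
      ext j
      by_cases hj : j = i <;> simp_all [le_of_lt]
    rw [h, hpos, hneg, Set.ncard_insert_of_notMem (by simp [hi]), ← hd.1, ← hd.2]
  · obtain ⟨t, ⟨A', hG, hS, h⟩, ht⟩ :=
      ((hev.filter_mono nhdsWithin_le_nhds).and (self_mem_nhdsWithin (s := Set.Iio 0))).exists
    refine ⟨A', hG, hS, ?_⟩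
    have hpos : {j | 0 < Function.update d i t j} = {j | 0 < d j} := by
      ext j
      by_cases hj : j = i <;> simp_all [le_of_lt]
    have hneg : {j | Function.update d i t j < 0} = insert i {j | d j < 0} := by
      ext j
      by_cases hj : j = i <;> simp_all
    rw [h, hpos, hneg, Set.ncard_insert_of_notMem (by simp [hi]), ← hd.1, ← hd.2]
end
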